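/- In S(F₃;ℂ), with α = g₃g₂⁻¹g₁g₂g₁⁻¹ and β = g₂⁻¹g₁g₂g₁⁻¹g₃, one has Φ(Q) = [αg₁] − [βg₁], where Q = −2x₁₂x₂₃ + 2x₂x₁₂₃ − x₁²x₂x₁₂₃ + x₁x₂x₁₂x₁₃ + x₁x₂x₂₃ + x₁x₁₂x₁₂₃ − x₁₂²x₁₃ − x₂²x₁₃. -/

import Mathlib

open MvPolynomial

noncomputable section

def skeinIdeal (R G : Type*) [CommRing R] [Group G] : Ideal (MvPolynomial G R) :=
  Ideal.span ({X (1 : G) - 2} ∪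
    {p | ∃ g h : G, p = X g * X h - X (g * h) - X (g * h⁻¹)})

abbrev SkeinAlgebra (R G : Type*) [CommRing R] [Group G] :=
  MvPolynomial G R ⧸ skeinIdeal R G

def cl (R : Type*) {G : Type*} [CommRing R] [Group G] (g : G) : SkeinAlgebra R G :=
  Ideal.Quotient.mk (skeinIdeal R G) (X g)

/-- The free group on three generators. -/
abbrev F3 := FreeGroup (Fin 3)

def g1 : F3 := FreeGroup.of 0
def g2 : F3 := FreeGroup.of 1
def g3 : F3 := FreeGroup.of 2

/-- The words `g₁, g₂, g₃, g₁g₂, g₁g₃, g₂g₃, g₁g₂g₃` indexed by the seven variables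
`x₁, x₂, x₃, x₁₂, x₁₃, x₂₃, x₁₂₃`. -/
def word : Fin 7 → F3 := ![g1, g2, g3, g1 * g2, g1 * g3, g2 * g3, g1 * g2 * g3]

/-- `Φ : ℂ[x₁,…,x₁₂₃] → S(F₃;ℂ)`, `x_{i₁⋯i_k} ↦ [g_{i₁}⋯g_{i_k}]`. -/
def Phi : MvPolynomial (Fin 7) ℂ →ₐ[ℂ] SkeinAlgebra ℂ F3 :=
  aeval fun i => cl ℂ (word i)

-- the seven variables
def x1 : MvPolynomial (Fin 7) ℂ := X 0
def x2 : MvPolynomial (Fin 7) ℂ := X 1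
def x3 : MvPolynomial (Fin 7) ℂ := X 2
def x12 : MvPolynomial (Fin 7) ℂ := X 3
def x13 : MvPolynomial (Fin 7) ℂ := X 4
def x23 : MvPolynomial (Fin 7) ℂ := X 5
def x123 : MvPolynomial (Fin 7) ℂ := X 6

/-- The polynomial `K`. -/
def K : MvPolynomial (Fin 7) ℂ :=
  x123 ^ 2 - (x12 * x3 + x13 * x2 + x23 * x1 - x1 * x2 * x3) * x123
    + x1 ^ 2 + x2 ^ 2 + x3 ^ 2 + x12 ^ 2 + x23 ^ 2 + x13 ^ 2
    - x1 * x2 * x12 - x1 * x3 * x13 - x2 * x3 * x23 + x12 * x13 * x23 - 4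

def ralpha : F3 := g3 * g2⁻¹ * g1 * g2 * g1⁻¹
def rbeta : F3 := g2⁻¹ * g1 * g2 * g1⁻¹ * g3

def Q : MvPolynomial (Fin 7) ℂ :=
  -2*x12*x23 + 2*x2*x123 - x1^2*x2*x123 + x1*x2*x12*x13 + x1*x2*x23
    + x1*x12*x123 - x12^2*x13 - x2^2*x13

section SkeinRelations

variable {R G : Type*} [CommRing R] [Group G]

lemma cl_one : cl R (1 : G) = 2 := by
  have h : Ideal.Quotient.mk (skeinIdeal R G) (X (1 : G) - 2) = 0 :=
    Ideal.Quotient.eq_zero_iff_mem.2 (Ideal.subset_span (Or.inl rfl))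
  rw [map_sub, map_ofNat] at h
  exact sub_eq_zero.1 h

lemma cl_mul_cl (g h : G) : cl R g * cl R h = cl R (g * h) + cl R (g * h⁻¹) := by
  have H : Ideal.Quotient.mk (skeinIdeal R G) (X g * X h - X (g * h) - X (g * h⁻¹)) = 0 :=
    Ideal.Quotient.eq_zero_iff_mem.2 (Ideal.subset_span (Or.inr ⟨g, h, rfl⟩))
  rw [map_sub, map_sub, map_mul, sub_sub] at H
  exact sub_eq_zero.1 H

lemma cl_inv (g : G) : cl R g⁻¹ = cl R g := by
  have h := cl_mul_cl (R := R) 1 g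
  rw [cl_one, one_mul, one_mul] at h
  linear_combination -h

lemma cl_mul_comm (g h : G) : cl R (g * h) = cl R (h * g) := by
  have h₁ := cl_mul_cl (R := R) g h
  have h₂ := cl_mul_cl (R := R) h g
  have h₃ := cl_inv (R := R) (g * h⁻¹)
  rw [mul_inv_rev, inv_inv] at h₃
  linear_combination h₂ - h₁ + h₃

lemma cl_conj (g h : G) : cl R (g * h * g⁻¹) = cl R h := by
  rw [cl_mul_comm, inv_mul_cancel_left]

lemma cl_mul_inv (g h : G) : cl R (g * h⁻¹) = cl R g * cl R h - cl R (g * h) := by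
  rw [cl_mul_cl, add_sub_cancel_left]

lemma cl_mul (g h : G) : cl R (g * h) = cl R g * cl R h - cl R (g * h⁻¹) := by
  rw [cl_mul_cl, add_sub_cancel_right]

lemma cl_mul_self_mul (g h : G) : cl R (g * (g * h)) = cl R g * cl R (g * h) - cl R h := by
  rw [cl_mul, mul_inv_rev, ← mul_assoc, cl_conj, cl_inv]

lemma cl_mul_mul_mul (a b c : G) :
    cl R (a * b * (a * c)) = cl R (a * b) * cl R (a * c) - cl R b * cl R c + cl R (b * c) := by
  have h : a * b * (a * c)⁻¹ = a * (b * c⁻¹) * a⁻¹ := by group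
  rw [cl_mul, h, cl_conj, cl_mul_inv]
  ring

lemma cl_mul_inv_mul_mul (a b c : G) :
    cl R (c * b⁻¹ * a * b)
      = cl R b * cl R (a * b * c) - cl R (a * b) * cl R (b * c) + cl R a * cl R c
        - cl R (a * c) := by
  have h₁ : cl R (c * b⁻¹ * a * b) = cl R (a * b * c * b⁻¹) := by
    rw [mul_assoc, cl_mul_comm]
    group
  have h₂ : cl R (a * b * c * b) = cl R (b * a * (b * c)) := by
    rw [cl_mul_comm]
    group
  rw [h₁, cl_mul_inv, h₂, cl_mul_mul_mul, cl_mul_comm b a]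
  ring

lemma cl_mul_mul_mul_mul (a b c : G) :
    cl R (a * b * a * c * a)
      = cl R (a * b) * (cl R a * cl R (a * c) - cl R c)
        - cl R (a * c) * cl R b + cl R (a * b * c) := by
  have h₁ : a * b * a * c * a = a * b * (a * c * a) := by group
  have h₂ : a * b * (a * c * a)⁻¹ = a * (b * (c * a)⁻¹) * a⁻¹ := by group
  rw [h₁, cl_mul, h₂, cl_conj, cl_mul_inv, cl_mul_comm (a * c) a, cl_mul_self_mul,
    cl_mul_comm c a, ← mul_assoc b c a, cl_mul_comm _ a, ← mul_assoc a b c]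
  ring

lemma cl_inv_mul_mul_inv_mul (a b c : G) :
    cl R (b⁻¹ * a * b * a⁻¹ * c * a)
      = cl R a * (cl R b * (cl R a * cl R (a * b * c) - cl R (b * c))
          - (cl R (a * b) * cl R (a * b * c) - cl R c))
        - (cl R b * cl R (a * b * a * c * a)
          - (cl R (a * b) * cl R (a * b * (a * c)) - cl R (a * c))) := by
  have h₁ : cl R (b⁻¹ * a * b * a⁻¹ * c * a) = cl R (c * a * b⁻¹ * a * b * a⁻¹) := by
    rw [mul_assoc, cl_mul_comm]
    group
  have h₂ : cl R (c * a * b⁻¹ * a * b) = cl R (a * b * c * a * b⁻¹) := by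
    rw [mul_assoc _ a b, cl_mul_comm]
    group
  have h₃ : cl R (a * b * c * a * b) = cl R (a * b * (a * b * c)) := by
    rw [mul_assoc _ a b, cl_mul_comm]
  have h₄ : cl R (c * a * b⁻¹ * a * b * a) = cl R (a * b * a * c * a * b⁻¹) := by
    rw [mul_assoc _ b a, mul_assoc _ a (b * a), cl_mul_comm]
    group
  have h₅ : cl R (a * b * a * c * a * b) = cl R (a * b * (a * b * (a * c))) := by
    rw [mul_assoc _ a b, cl_mul_comm, mul_assoc (a * b)]
  have h₆ : cl R (a * b * c * a) = cl R a * cl R (a * b * c) - cl R (b * c) := by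
    rw [cl_mul_comm, mul_assoc a b c, cl_mul_self_mul]
  rw [h₁, cl_mul_inv, h₂, h₄, cl_mul_inv, cl_mul_inv _ b, h₃, h₅, h₆, cl_mul_self_mul,
    cl_mul_self_mul]
  ring

end SkeinRelations

theorem phi_Q_alpha_g1 : Phi Q = cl ℂ (ralpha * g1) - cl ℂ (rbeta * g1) := by
  have hα : ralpha * g1 = g3 * g2⁻¹ * g1 * g2 := inv_mul_cancel_right _ _
  rw [hα, rbeta, cl_mul_inv_mul_mul, cl_inv_mul_mul_inv_mul, cl_mul_mul_mul_mul, cl_mul_mul_mul]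
  simp only [Phi, Q, x1, x2, x12, x13, x23, x123, map_add, map_sub, map_mul, map_neg, map_pow,
    map_ofNat, aeval_X, word, Matrix.cons_val]
  ring
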